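/- Let G be a simple graph on n ≥ 6 vertices that is both θ(1,2,2)-free and F₅-free. Then the signless Laplacian spectral radius satisfies q(G) ≤ q(S_{n,1}⁺), with equality if and only if G is isomorphic to S_{n,1}⁺. -/

import Mathlib

open SimpleGraph Finset

/-- The signless Laplacian spectral radius of a graph: the largest real eigenvalue
(root of the characteristic polynomial) of `Q(G) = D(G) + A(G)`. -/
noncomputable def qrad {n : ℕ} (G : SimpleGraph (Fin n)) : ℝ :=
  letI := Classical.decRel G.Adj
  sSup {x : ℝ | (Matrix.charpoly (G.degMatrix ℝ + G.adjMatrix ℝ)).IsRoot x}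

/-- `contains H G` : `G` contains a subgraph isomorphic to `H`. -/
def contains {α β : Type*} (H : SimpleGraph α) (G : SimpleGraph β) : Prop :=
  ∃ f : α → β, Function.Injective f ∧ ∀ a b, H.Adj a b → G.Adj (f a) (f b)

/-- The theta graph θ(1,2,2) (= K₄ minus an edge). -/
def theta122 : SimpleGraph (Fin 4) :=
  SimpleGraph.fromEdgeSet {s(0,1), s(0,2), s(1,2), s(0,3), s(1,3)}

/-- The theta graph θ(1,2,3). -/
def theta123 : SimpleGraph (Fin 5) :=
  SimpleGraph.fromEdgeSet {s(0,1), s(0,2), s(2,1), s(0,3), s(3,4), s(4,1)}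

/-- The friendship graph `F n`: center `0`; the other vertices are paired up
`{1,2}, {3,4}, …` into triangles through the center, with a pendant vertex left
over when `n` is even. -/
def friendship (n : ℕ) : SimpleGraph (Fin n) :=
  SimpleGraph.fromRel (fun i j => i.val = 0 ∨ (i.val + 1) / 2 = (j.val + 1) / 2)

/-- `Sgraph n k` = `S_{n,k}`, the join of `K_k` with `n - k` isolated vertices. -/
def Sgraph (n k : ℕ) : SimpleGraph (Fin n) :=
  SimpleGraph.fromRel (fun i _ => i.val < k)

/-- `Splus n` = `S_{n,1}⁺`, the star `K_{1,n-1}` plus one edge between two leaves. -/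
def Splus (n : ℕ) : SimpleGraph (Fin n) :=
  SimpleGraph.fromRel (fun i j => i.val = 0 ∨ (i.val = 1 ∧ j.val = 2))

/-- `K₁ ∨ ((n-1)/3) K₃` : vertex `0` joined to `(n-1)/3` disjoint triangles. -/
def joinK3s (n : ℕ) : SimpleGraph (Fin n) :=
  SimpleGraph.fromRel (fun i j => i.val = 0 ∨ (i.val - 1) / 3 = (j.val - 1) / 3)

/-- The number of edges of `G` lying inside the vertex set `s` (the number of
edges of the induced subgraph `G[s]`). -/
noncomputable def edgesIn {V : Type*} (G : SimpleGraph V) (s : Set V) : ℕ :=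
  {e | e ∈ G.edgeSet ∧ ∀ v ∈ e, v ∈ s}.ncard

open scoped Classical in
/-- `x` is a nonzero eigenvector of the signless Laplacian. -/
def QEig {n : ℕ} (G : SimpleGraph (Fin n)) (l : ℝ) (x : Fin n → ℝ) : Prop :=
  x ≠ 0 ∧ ∀ i, ∑ u, (if G.Adj i u then x i + x u else 0) = l * x i

open scoped Classical in
lemma root_iff {n : ℕ} (G : SimpleGraph (Fin n)) (inst : DecidableRel G.Adj) (l : ℝ) :
    (Matrix.charpoly (G.degMatrix ℝ + G.adjMatrix ℝ)).IsRoot l ↔ ∃ x, QEig G l x := by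
  rw [Polynomial.IsRoot, Matrix.eval_charpoly, ← Matrix.exists_mulVec_eq_zero_iff]
  refine exists_congr fun x => and_congr Iff.rfl ?_
  rw [funext_iff]
  refine forall_congr' fun i => ?_
  have h1 : ((Matrix.scalar (Fin n) l - (G.degMatrix ℝ + G.adjMatrix ℝ)).mulVec x) i
      = l * x i - ∑ u, (if G.Adj i u then x i + x u else 0) := by
    rw [Matrix.sub_mulVec, Matrix.add_mulVec]
    simp only [Pi.sub_apply, Pi.add_apply, SimpleGraph.adjMatrix_mulVec_apply,
      SimpleGraph.degMatrix, Matrix.mulVec_diagonal, Matrix.scalar_apply]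
    rw [← Finset.sum_filter, Finset.sum_add_distrib, Finset.sum_const, nsmul_eq_mul]
    rw [SimpleGraph.neighborFinset_eq_filter, ← SimpleGraph.card_neighborFinset_eq_degree,
      SimpleGraph.neighborFinset_eq_filter]
  have h2 : (∑ u, @ite ℝ (G.Adj i u) (Classical.propDecidable _) (x i + x u) 0) =
      ∑ u, (if G.Adj i u then x i + x u else 0) := by congr!
  rw [h1, h2]
  simp only [Pi.zero_apply]
  constructor <;> intro h <;> linarith

lemma qrad_eq {n : ℕ} (G : SimpleGraph (Fin n)) : qrad G = sSup {l : ℝ | ∃ x, QEig G l x} := by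
  unfold qrad
  congr 1
  ext l
  exact root_iff G _ l

open scoped Classical in
lemma eig_le {n : ℕ} (G : SimpleGraph (Fin n)) (c l : ℝ) (x y : Fin n → ℝ)
    (hx : QEig G l x) (hy : ∀ i, 0 < y i)
    (h : ∀ i, ∑ u, (if G.Adj i u then y i + y u else 0) ≤ c * y i) : l ≤ c := by
  obtain ⟨h0, he⟩ := hx
  obtain ⟨j, hj⟩ := Function.ne_iff.mp h0
  obtain ⟨v, -, hv⟩ := Finset.exists_max_image Finset.univ (fun i => |x i| / y i) ⟨j, mem_univ j⟩
  set t := |x v| / y v with ht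
  have hle : ∀ i, |x i| ≤ t * y i := fun i => (div_le_iff₀ (hy i)).1 (hv i (mem_univ i))
  have heq : |x v| = t * y v := by rw [ht]; field_simp [(hy v).ne']
  have htpos : 0 < t := lt_of_lt_of_le (div_pos (abs_pos.2 hj) (hy j)) (hv j (mem_univ j))
  have hxv : 0 < |x v| := by rw [heq]; exact mul_pos htpos (hy v)
  have : l * |x v| ≤ c * |x v| := by
    calc l * |x v| ≤ |l * x v| := by
          rw [abs_mul]; exact mul_le_mul_of_nonneg_right (le_abs_self l) (abs_nonneg _)
      _ = |∑ u, (if G.Adj v u then x v + x u else 0)| := by rw [he]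
      _ ≤ ∑ u, |if G.Adj v u then x v + x u else 0| := Finset.abs_sum_le_sum_abs _ _
      _ ≤ ∑ u, t * (if G.Adj v u then y v + y u else 0) := by
          refine Finset.sum_le_sum fun u _ => ?_
          split_ifs
          · have := abs_add_le (x v) (x u)
            have := hle v
            have := hle u
            linarith
          · simp
      _ ≤ t * (c * y v) := by
          rw [← Finset.mul_sum]; exact mul_le_mul_of_nonneg_left (h v) htpos.le
      _ = c * |x v| := by rw [heq]; ring
  exact le_of_mul_le_mul_right this hxv

open scoped Classical in
lemma qrad_le {n : ℕ} (G : SimpleGraph (Fin n)) (c : ℝ) (hc : 0 ≤ c) (y : Fin n → ℝ)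
    (hy : ∀ i, 0 < y i)
    (h : ∀ i, ∑ u, (if G.Adj i u then y i + y u else 0) ≤ c * y i) : qrad G ≤ c := by
  rw [qrad_eq]
  refine Real.sSup_le ?_ hc
  rintro l ⟨x, hx⟩
  exact eig_le G c l x y hx hy h

lemma le_qrad {n : ℕ} (G : SimpleGraph (Fin n)) (l : ℝ) (x : Fin n → ℝ)
    (hx : QEig G l x) : l ≤ qrad G := by
  classical
  unfold qrad
  refine le_csSup ?_ ((root_iff G _ l).2 ⟨x, hx⟩)
  refine Set.Finite.bddAbove ?_
  exact Polynomial.finite_setOfPred_isRoot (Matrix.charpoly_monic _).ne_zero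

lemma qeig_iso {n : ℕ} {G H : SimpleGraph (Fin n)} (e : G ≃g H) (l : ℝ) (x : Fin n → ℝ)
    (hx : QEig G l x) : QEig H l (fun i => x (e.symm i)) := by
  obtain ⟨h0, he⟩ := hx
  refine ⟨?_, fun i => ?_⟩
  · obtain ⟨j, hj⟩ := Function.ne_iff.mp h0
    exact Function.ne_iff.mpr ⟨e j, by simpa using hj⟩
  · rw [← he]
    refine (Fintype.sum_equiv e.toEquiv _ _ fun u => ?_).symm
    have h : G.Adj (e.symm i) u ↔ H.Adj i (e u) := by
      rw [← e.map_adj_iff]; simp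
    by_cases hh : H.Adj i (e u)
    · simp [h, hh]
    · simp [h, hh]

lemma qrad_iso {n : ℕ} {G H : SimpleGraph (Fin n)} (e : G ≃g H) : qrad G = qrad H := by
  rw [qrad_eq, qrad_eq]
  congr 1
  ext l
  exact ⟨fun ⟨x, hx⟩ => ⟨_, qeig_iso e l x hx⟩, fun ⟨x, hx⟩ => ⟨_, qeig_iso e.symm l x hx⟩⟩

lemma exists_root (n : ℝ) (hn : 6 ≤ n) :
    ∃ q, n < q ∧ (q - (n - 1)) * ((q - 3) * (q - 1)) = 2 * (q - 1) + (n - 3) * (q - 3) := by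
  let f : ℝ → ℝ := fun q => (q - (n - 1)) * ((q - 3) * (q - 1)) - (2 * (q - 1) + (n - 3) * (q - 3))
  have hf : Continuous f := by fun_prop
  have h1 : f n < 0 := by simp only [f]; nlinarith
  have h2 : 0 ≤ f (n + 1) := by simp only [f]; nlinarith
  obtain ⟨q, hq, hq0⟩ := intermediate_value_Icc (by linarith : n ≤ n + 1) hf.continuousOn
    ⟨h1.le, h2⟩
  refine ⟨q, lt_of_le_of_ne hq.1 ?_, by simp only [f] at hq0; linarith⟩
  rintro rfl
  linarith

lemma splus_adj (n : ℕ) (i j : Fin n) : (Splus n).Adj i j ↔ i ≠ j ∧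
    (i.val = 0 ∨ j.val = 0 ∨ (i.val = 1 ∧ j.val = 2) ∨ (i.val = 2 ∧ j.val = 1)) := by
  simp only [Splus, SimpleGraph.fromRel_adj]
  tauto

open scoped Classical in
lemma qrad_splus (n : ℕ) (hn : 6 ≤ n) : (n : ℝ) < qrad (Splus n) := by
  have hn' : (6 : ℝ) ≤ n := by exact_mod_cast hn
  obtain ⟨q, hq, he⟩ := exists_root n hn'
  refine lt_of_lt_of_le hq (le_qrad _ q (fun i => if i.val = 0 then (q - 3) * (q - 1) else
    if i.val = 1 ∨ i.val = 2 then q - 1 else q - 3) ⟨?_, fun i => ?_⟩)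
  · refine Function.ne_iff.mpr ⟨⟨0, by omega⟩, ?_⟩
    simp only [if_true, Pi.zero_apply]
    exact mul_ne_zero (by linarith) (by linarith)
  · obtain ⟨m, rfl⟩ : ∃ m, n = m + 3 := ⟨n - 3, by omega⟩
    have e1 : 2 % (m + 3) = 2 := Nat.mod_eq_of_lt (by omega)
    rw [Fin.sum_univ_succ, Fin.sum_univ_succ, Fin.sum_univ_succ]
    simp only [splus_adj]
    refine Fin.cases ?_ (fun i => Fin.cases ?_ (fun i => Fin.cases ?_ (fun i => ?_) i) i) i
    · simp [Fin.ext_iff, e1]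
      push_cast at he
      linarith
    · simp [Fin.ext_iff, e1]
      ring
    · simp [Fin.ext_iff, e1]
      ring
    · simp [Fin.ext_iff, e1]
      ring

lemma theta_free {n : ℕ} {G : SimpleGraph (Fin n)} (h1 : ¬ contains theta122 G)
    {p q r s : Fin n} (hpq : G.Adj p q) (hpr : G.Adj p r) (hqr : G.Adj q r)
    (hps : G.Adj p s) (hqs : G.Adj q s) : r = s := by
  by_contra hrs
  refine h1 ⟨![p, q, r, s], ?_, ?_⟩
  · have := hpq.ne; have := hpr.ne; have := hqr.ne; have := hps.ne; have := hqs.ne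
    intro i j hij
    fin_cases i <;> fin_cases j <;> simp_all
  · intro i j hij
    fin_cases i <;> fin_cases j <;> simp_all [theta122, SimpleGraph.adj_comm]

lemma f5_free {n : ℕ} {G : SimpleGraph (Fin n)} (h2 : ¬ contains (friendship 5) G)
    {o a b c d : Fin n} (ha : G.Adj o a) (hb : G.Adj o b) (hc : G.Adj o c) (hd : G.Adj o d)
    (hab : G.Adj a b) (hcd : G.Adj c d) (hac : a ≠ c) (had : a ≠ d) (hbc : b ≠ c)
    (hbd : b ≠ d) : False := by
  refine h2 ⟨![o, a, b, c, d], ?_, ?_⟩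
  · have := ha.ne; have := hb.ne; have := hc.ne; have := hd.ne; have := hab.ne; have := hcd.ne
    intro i j hij
    fin_cases i <;> fin_cases j <;> simp_all
  · intro i j hij
    fin_cases i <;> fin_cases j <;> simp_all [friendship, SimpleGraph.adj_comm]

lemma edge_unique {n : ℕ} {G : SimpleGraph (Fin n)} (h1 : ¬ contains theta122 G)
    (h2 : ¬ contains (friendship 5) G)
    {v a b u w : Fin n} (ha : G.Adj v a) (hb : G.Adj v b) (hab : G.Adj a b)
    (hu : G.Adj v u) (hw : G.Adj v w) (huw : G.Adj u w) :
    (u = a ∧ w = b) ∨ (u = b ∧ w = a) := by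
  by_cases e1 : a = u
  · subst e1
    exact Or.inl ⟨rfl, theta_free h1 ha hw huw hb hab⟩
  by_cases e2 : a = w
  · subst e2
    exact Or.inr ⟨theta_free h1 ha hu huw.symm hb hab, rfl⟩
  by_cases e3 : b = u
  · subst e3
    exact Or.inr ⟨rfl, theta_free h1 hb hw huw ha hab.symm⟩
  by_cases e4 : b = w
  · subst e4
    exact Or.inl ⟨theta_free h1 hb hu huw.symm ha hab.symm, rfl⟩
  exact (f5_free h2 ha hb hu hw hab huw e1 e2 e3 e4).elim

open scoped Classical in
/-- The degree as a real number. -/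
noncomputable def rdeg {n : ℕ} (G : SimpleGraph (Fin n)) (v : Fin n) : ℝ :=
  ∑ u, if G.Adj v u then 1 else 0

open scoped Classical in
/-- The number of common neighbours as a real number. -/
noncomputable def rcod {n : ℕ} (G : SimpleGraph (Fin n)) (v w : Fin n) : ℝ :=
  ∑ u, if G.Adj v u ∧ G.Adj u w then 1 else 0

open scoped Classical in
lemma sum_deg {n : ℕ} (G : SimpleGraph (Fin n)) (v : Fin n) :
    ∑ u, (if G.Adj v u then rdeg G v + rdeg G u else 0) =
      rdeg G v * rdeg G v + ∑ w, rcod G v w := by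
  have h1 : ∀ u, (if G.Adj v u then rdeg G v + rdeg G u else 0) =
      rdeg G v * (if G.Adj v u then 1 else 0) +
        ∑ w, (if G.Adj v u ∧ G.Adj u w then (1 : ℝ) else 0) := by
    intro u
    by_cases h : G.Adj v u
    · simp only [h, if_true, true_and, mul_one]
      rfl
    · simp [h]
  simp only [h1]
  rw [Finset.sum_add_distrib, ← Finset.mul_sum, Finset.sum_comm]
  rfl

lemma rcod_le {n : ℕ} (G : SimpleGraph (Fin n)) (v w : Fin n) : rcod G v w ≤ rdeg G v := by
  classical
  refine Finset.sum_le_sum fun u _ => ?_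
  by_cases h : G.Adj v u
  · simp only [h, true_and, if_true]; split_ifs <;> norm_num
  · simp [h]

lemma rcod_le_sub {n : ℕ} (G : SimpleGraph (Fin n)) (v w a : Fin n) (ha : G.Adj v a)
    (hw : ¬ G.Adj a w) : rcod G v w ≤ rdeg G v - 1 := by
  classical
  have : rdeg G v - 1 = ∑ u, ((if G.Adj v u then (1 : ℝ) else 0) - if u = a then 1 else 0) := by
    rw [Finset.sum_sub_distrib]; simp [rdeg]
  rw [this]
  refine Finset.sum_le_sum fun u _ => ?_
  by_cases e : u = a
  · subst e; simp [ha, hw]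
  by_cases h : G.Adj v u
  · simp only [h, true_and, if_true, e, if_false]; split_ifs <;> norm_num
  · simp [h, e]

lemma rcod_zero {n : ℕ} (G : SimpleGraph (Fin n)) (v w : Fin n)
    (h : ∀ u, G.Adj v u → ¬ G.Adj u w) : rcod G v w = 0 := by
  classical
  refine Finset.sum_eq_zero fun u _ => ?_
  rw [if_neg]
  exact fun hh => h u hh.1 hh.2

lemma rcod_le_one {n : ℕ} (G : SimpleGraph (Fin n)) (v w b : Fin n)
    (h : ∀ u, G.Adj v u → G.Adj u w → u = b) : rcod G v w ≤ 1 := by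
  classical
  have : (1 : ℝ) = ∑ u, (if u = b then (1 : ℝ) else 0) := by simp
  rw [this]
  refine Finset.sum_le_sum fun u _ => ?_
  by_cases e : u = b
  · simp only [e, if_true]; split_ifs <;> norm_num
  · rw [if_neg fun hh => e (h u hh.1 hh.2), if_neg e]

lemma bound_zero {n : ℕ} (G : SimpleGraph (Fin n)) (v : Fin n)
    (h : ∀ a b, G.Adj v a → G.Adj v b → ¬ G.Adj a b) :
    rdeg G v * rdeg G v + ∑ w, rcod G v w ≤ n * rdeg G v := by
  classical
  have h1 : ∑ w, rcod G v w ≤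
      ∑ w, (rdeg G v - rdeg G v * (if G.Adj v w then 1 else 0)) := by
    refine Finset.sum_le_sum fun w _ => ?_
    by_cases hw : G.Adj v w
    · rw [rcod_zero G v w fun u hu => h u w hu hw]; simp [hw]
    · simpa [hw] using rcod_le G v w
  rw [Finset.sum_sub_distrib, ← Finset.mul_sum] at h1
  change _ ≤ _ - rdeg G v * rdeg G v at h1
  simp at h1
  linarith

lemma bound_one {n : ℕ} (G : SimpleGraph (Fin n)) (h1 : ¬ contains theta122 G)
    (h2 : ¬ contains (friendship 5) G) (v a b : Fin n)
    (ha : G.Adj v a) (hb : G.Adj v b) (hab : G.Adj a b) (hd : rdeg G v ≤ n - 3) :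
    rdeg G v * rdeg G v + ∑ w, rcod G v w ≤ n * rdeg G v := by
  classical
  have h1 : ∑ w, rcod G v w ≤
      ∑ w, ((rdeg G v - 1) - (rdeg G v - 1) * (if G.Adj v w then 1 else 0)
        + (if w = v then 1 else 0) + (if w = a then 1 else 0) + (if w = b then 1 else 0)) := by
    refine Finset.sum_le_sum fun w _ => ?_
    by_cases e1 : w = v
    · subst e1
      simpa [ha.ne, hb.ne] using rcod_le G w w
    by_cases e2 : w = a
    · subst e2
      have := rcod_le_one G v w b fun u hu huw => by
        rcases edge_unique h1 h2 ha hb hab hu ha huw with h | h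
        · exact absurd h.2 hab.ne
        · exact h.1
      simpa [ha, ha.ne', hab.ne] using this
    by_cases e3 : w = b
    · subst e3
      have := rcod_le_one G v w a fun u hu huw => by
        rcases edge_unique h1 h2 ha hb hab hu hb huw with h | h
        · exact h.1
        · exact absurd h.2 hab.ne'
      simpa [hb, hb.ne', hab.ne'] using this
    by_cases hw : G.Adj v w
    · rw [rcod_zero G v w fun u hu huw => ?_]
      · simp [hw, e1, e2, e3]
      · rcases edge_unique h1 h2 ha hb hab hu hw huw with h | h
        · exact e3 h.2
        · exact e2 h.2
    · simp only [hw, e1, e2, e3, if_false, mul_zero, sub_zero, add_zero]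
      by_cases haw : G.Adj a w
      · refine rcod_le_sub G v w b hb fun hbw => e1 ?_
        exact theta_free h1 hab haw hbw ha.symm hb.symm
      · exact rcod_le_sub G v w a ha haw
  rw [Finset.sum_add_distrib, Finset.sum_add_distrib, Finset.sum_add_distrib,
    Finset.sum_sub_distrib, ← Finset.mul_sum] at h1
  change _ ≤ _ - (rdeg G v - 1) * rdeg G v + _ + _ + _ at h1
  simp at h1
  nlinarith

lemma rdeg_nonneg {n : ℕ} (G : SimpleGraph (Fin n)) (v : Fin n) : 0 ≤ rdeg G v := by
  classical
  exact Finset.sum_nonneg fun u _ => by split_ifs <;> norm_num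

lemma rdeg_pos {n : ℕ} (G : SimpleGraph (Fin n)) {v u : Fin n} (h : G.Adj v u) :
    0 < rdeg G v := by
  classical
  refine Finset.sum_pos' (fun u _ => by split_ifs <;> norm_num) ⟨u, Finset.mem_univ u, ?_⟩
  simp [h]

/-- The generic case. -/
lemma case_generic {n : ℕ} (G : SimpleGraph (Fin n)) (h1 : ¬ contains theta122 G)
    (h2 : ¬ contains (friendship 5) G)
    (h : ∀ v a b, G.Adj v a → G.Adj v b → G.Adj a b → rdeg G v ≤ n - 3) : qrad G ≤ n := by
  classical
  refine qrad_le G n (Nat.cast_nonneg n) (fun i => if rdeg G i = 0 then 1 else rdeg G i) ?_ ?_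
  · intro i
    split_ifs with h0
    · norm_num
    · exact lt_of_le_of_ne (rdeg_nonneg G i) (Ne.symm h0)
  · intro i
    have e : (∑ u, if G.Adj i u then (if rdeg G i = 0 then 1 else rdeg G i) +
        (if rdeg G u = 0 then 1 else rdeg G u) else 0) =
        ∑ u, (if G.Adj i u then rdeg G i + rdeg G u else 0) := by
      refine Finset.sum_congr rfl fun u _ => ?_
      by_cases hu : G.Adj i u
      · simp [hu, (rdeg_pos G hu).ne', (rdeg_pos G hu.symm).ne']
      · simp [hu]
    rw [e, sum_deg]
    have key : rdeg G i * rdeg G i + ∑ w, rcod G i w ≤ n * rdeg G i := by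
      by_cases hh : ∃ a b, G.Adj i a ∧ G.Adj i b ∧ G.Adj a b
      · obtain ⟨a, b, ha, hb, hab⟩ := hh
        exact bound_one G h1 h2 i a b ha hb hab (h i a b ha hb hab)
      · push Not at hh
        exact bound_zero G i hh
    refine key.trans ?_
    split_ifs with h0
    · rw [h0]; simp
    · exact le_rfl

/-- The case of a vertex of degree `n - 2` in a triangle. -/
lemma case_two {n : ℕ} (hn : 6 ≤ n) (G : SimpleGraph (Fin n)) (h1 : ¬ contains theta122 G)
    (h2 : ¬ contains (friendship 5) G) (v a b w : Fin n) (ha : G.Adj v a) (hb : G.Adj v b)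
    (hab : G.Adj a b) (hwv : w ≠ v) (hvw : ¬ G.Adj v w) (hall : ∀ u, u ≠ v → u ≠ w → G.Adj v u)
    (hbw : ¬ G.Adj b w) : qrad G ≤ n := by
  classical
  have hn' : (6 : ℝ) ≤ n := by exact_mod_cast hn
  have hva := ha.ne
  have hvb := hb.ne
  have habn := hab.ne
  have hwa : w ≠ a := by rintro rfl; exact hvw ha
  have hwb : w ≠ b := by rintro rfl; exact hvw hb
  -- the only edges avoiding `v` and `w`
  have huniq : ∀ x y, x ≠ v → x ≠ w → y ≠ v → y ≠ w → G.Adj x y →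
      (x = a ∧ y = b) ∨ (x = b ∧ y = a) := fun x y h1' h2' h3 h4 hxy =>
    edge_unique h1 h2 ha hb hab (hall x h1' h2') (hall y h3 h4) hxy
  let y : Fin n → ℝ := fun i => 3 + (2 * n - 7) * (if i = v then 1 else 0) +
    (n - 5) * (if i = w then 1 else 0) + 3 * (if i = a then 1 else 0) + (if i = b then 1 else 0)
  have yv : y v = 2 * n - 4 := by simp [y, hwv.symm, hva, hvb]; ring
  have yw : y w = n - 2 := by simp [y, hwv, hwa, hwb]; ring
  have ya : y a = 6 := by simp [y, hva.symm, hwa.symm, habn]; norm_num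
  have yb : y b = 4 := by simp [y, hvb.symm, hwb.symm, habn.symm]; norm_num
  have yc : ∀ c, c ≠ v → c ≠ w → c ≠ a → c ≠ b → y c = 3 := by
    intro c h1 h2 h3 h4; simp [y, h1, h2, h3, h4]
  have ysum : ∑ i, y i = 6 * n - 8 := by
    simp only [y, Finset.sum_add_distrib, ← Finset.mul_sum]
    simp
    ring
  have ypos : ∀ i, 0 < y i := by
    intro i
    by_cases i1 : i = v
    · rw [i1, yv]; linarith
    by_cases i2 : i = w
    · rw [i2, yw]; linarith
    by_cases i3 : i = a
    · rw [i3, ya]; norm_num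
    by_cases i4 : i = b
    · rw [i4, yb]; norm_num
    rw [yc i i1 i2 i3 i4]; norm_num
  -- bound by a sum over a set containing the neighbourhood
  have hsub : ∀ (i : Fin n) (s : Finset (Fin n)), (∀ u, G.Adj i u → u ∈ s) →
      ∑ u, (if G.Adj i u then y i + y u else 0) ≤ ∑ u ∈ s, (y i + y u) := by
    intro i s hs
    rw [← Finset.sum_filter]
    refine Finset.sum_le_sum_of_subset_of_nonneg ?_ ?_
    · intro u hu; exact hs u (by simpa using hu)
    · intro u _ _; have := ypos i; have := ypos u; linarith
  have hcompl : ∀ (c : ℝ) (s : Finset (Fin n)), ∑ u ∈ sᶜ, (c + y u) =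
      n * c + (6 * n - 8) - ∑ u ∈ s, (c + y u) := by
    intro c s
    rw [eq_sub_iff_add_eq, Finset.sum_compl_add_sum, Finset.sum_add_distrib, ysum]
    simp
  refine qrad_le G n (Nat.cast_nonneg n) y ypos fun i => ?_
  by_cases i1 : i = v
  · subst i1
    refine (hsub i {i, w}ᶜ ?_).trans ?_
    · intro u hu
      have := hu.ne'
      have : u ≠ w := by rintro rfl; exact hvw hu
      simp_all
    · rw [hcompl, Finset.sum_pair hwv.symm, yw, yv]
      nlinarith
  by_cases i2 : i = w
  · subst i2
    refine (hsub i {i, v, b}ᶜ ?_).trans ?_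
    · intro u hu
      have := hu.ne'
      have : u ≠ v := by rintro rfl; exact hvw hu.symm
      have : u ≠ b := by rintro rfl; exact hbw hu.symm
      simp_all
    · rw [hcompl, Finset.sum_insert (by simp [hwv, hwb]), Finset.sum_pair hvb, yw, yv, yb]
      nlinarith
  by_cases i3 : i = a
  · subst i3
    refine (hsub i {v, w, b} ?_).trans ?_
    · intro u hu
      by_contra hc
      simp only [Finset.mem_insert, Finset.mem_singleton, not_or] at hc
      rcases huniq i u i1 i2 hc.1 hc.2.1 hu with h | h
      · exact hc.2.2 h.2
      · exact habn h.1
    · rw [Finset.sum_insert (by simp [hwv.symm, hvb]), Finset.sum_pair hwb, yw, yv, yb, ya]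
      linarith
  by_cases i4 : i = b
  · subst i4
    refine (hsub i {v, a} ?_).trans ?_
    · intro u hu
      by_contra hc
      simp only [Finset.mem_insert, Finset.mem_singleton, not_or] at hc
      have : u ≠ w := by rintro rfl; exact hbw hu
      rcases huniq i u i1 i2 hc.1 this hu with h | h
      · exact habn h.1.symm
      · exact hc.2 h.2
    · rw [Finset.sum_pair hva, yv, ya, yb]
      linarith
  · refine (hsub i {v, w} ?_).trans ?_
    · intro u hu
      by_contra hc
      simp only [Finset.mem_insert, Finset.mem_singleton, not_or] at hc
      rcases huniq i u i1 i2 hc.1 hc.2 hu with h | h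
      · exact i3 h.1
      · exact i4 h.1
    · rw [Finset.sum_pair hwv.symm, yv, yw, yc i i1 i2 i3 i4]
      linarith

/-- The case of a dominating vertex in a triangle. -/
lemma case_one {n : ℕ} (hn : 6 ≤ n) (G : SimpleGraph (Fin n)) (h1 : ¬ contains theta122 G)
    (h2 : ¬ contains (friendship 5) G) (v a b : Fin n) (ha : G.Adj v a) (hb : G.Adj v b)
    (hab : G.Adj a b) (hall : ∀ u, u ≠ v → G.Adj v u) : Nonempty (G ≃g Splus n) := by
  classical
  let f : Fin n → Fin n := fun i => if i.val = 0 then v else if i.val = 1 then a else b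
  let z0 : Fin n := ⟨0, by omega⟩
  let z1 : Fin n := ⟨1, by omega⟩
  let z2 : Fin n := ⟨2, by omega⟩
  have := ha.ne; have := hb.ne; have := hab.ne
  obtain ⟨g, hg⟩ := Finset.exists_equiv_extend_of_card_eq (α := Fin n) (β := Fin n)
    (t := Finset.univ) (by simp) (s := {z0, z1, z2}) (f := f) (Finset.subset_univ _) (by
      intro i hi j hj hij
      simp only [Finset.coe_insert, Finset.coe_singleton, Set.mem_insert_iff,
        Set.mem_singleton_iff] at hi hj
      rcases hi with rfl | rfl | rfl <;> rcases hj with rfl | rfl | rfl <;>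
        simp_all [f, z0, z1, z2])
  let e : Fin n ≃ Fin n := g.trans (Equiv.subtypeUnivEquiv (by simp))
  have e0 : e z0 = v := by simpa [e, f, z0] using hg z0 (by simp)
  have e1 : e z1 = a := by simpa [e, f, z1] using hg z1 (by simp)
  have e2 : e z2 = b := by simpa [e, f, z2] using hg z2 (by simp)
  refine ⟨(⟨e, ?_⟩ : Splus n ≃g G).symm⟩
  intro i j
  rw [splus_adj]
  have k0 : ∀ i : Fin n, i.val = 0 ↔ e i = v := fun i => by
    rw [← e0, e.apply_eq_iff_eq, Fin.ext_iff]
  have k1 : ∀ i : Fin n, i.val = 1 ↔ e i = a := fun i => by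
    rw [← e1, e.apply_eq_iff_eq, Fin.ext_iff]
  have k2 : ∀ i : Fin n, i.val = 2 ↔ e i = b := fun i => by
    rw [← e2, e.apply_eq_iff_eq, Fin.ext_iff]
  rw [k0, k0, k1, k1, k2, k2, ← e.injective.ne_iff]
  constructor
  · intro hadj
    refine ⟨hadj.ne, ?_⟩
    by_cases p : e i = v
    · exact Or.inl p
    by_cases q : e j = v
    · exact Or.inr (Or.inl q)
    exact Or.inr (Or.inr (edge_unique h1 h2 ha hb hab (hall _ p) (hall _ q) hadj))
  · rintro ⟨hne, h | h | h | h⟩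
    · rw [h] at hne ⊢; exact hall _ hne.symm
    · rw [h] at hne ⊢; exact (hall _ hne).symm
    · rw [h.1, h.2]; exact hab
    · rw [h.1, h.2]; exact hab.symm

lemma rdeg_le_of_two {n : ℕ} (G : SimpleGraph (Fin n)) (v w x : Fin n) (hwv : w ≠ v)
    (hxv : x ≠ v) (hwx : w ≠ x) (hw : ¬ G.Adj v w) (hx : ¬ G.Adj v x) : rdeg G v ≤ n - 3 := by
  classical
  have : (n : ℝ) - 3 = ∑ u : Fin n, ((1 : ℝ) - (if u = v then 1 else 0) - (if u = w then 1 else 0)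
      - (if u = x then 1 else 0)) := by
    simp only [Finset.sum_sub_distrib]
    simp
    ring
  rw [this]
  refine Finset.sum_le_sum fun u _ => ?_
  by_cases e1 : u = v
  · subst e1; simp [hwv.symm, hxv.symm]
  by_cases e2 : u = w
  · subst e2; simp [hwv, hwx, hw]
  by_cases e3 : u = x
  · subst e3; simp [hxv, hwx.symm, hx]
  simp only [e1, e2, e3, if_false, sub_zero]
  split_ifs <;> norm_num

lemma main_dichotomy {n : ℕ} (hn : 6 ≤ n) (G : SimpleGraph (Fin n))
    (h1 : ¬ contains theta122 G) (h2 : ¬ contains (friendship 5) G) :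
    Nonempty (G ≃g Splus n) ∨ qrad G ≤ n := by
  by_cases h : ∀ v a b, G.Adj v a → G.Adj v b → G.Adj a b → rdeg G v ≤ n - 3
  · exact Or.inr (case_generic G h1 h2 h)
  push Not at h
  obtain ⟨v, a, b, ha, hb, hab, hd⟩ := h
  by_cases hall : ∀ u, u ≠ v → G.Adj v u
  · exact Or.inl (case_one hn G h1 h2 v a b ha hb hab hall)
  push Not at hall
  obtain ⟨w, hwv, hvw⟩ := hall
  have hall : ∀ u, u ≠ v → u ≠ w → G.Adj v u := by
    intro u huv huw
    by_contra hu
    exact absurd (rdeg_le_of_two G v w u hwv huv huw.symm hvw hu) (not_le.2 hd)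
  right
  by_cases hbw : G.Adj b w
  · have haw : ¬ G.Adj a w := fun haw =>
      hwv (theta_free h1 hab haw hbw ha.symm hb.symm)
    exact case_two hn G h1 h2 v b a w hb ha hab.symm hwv hvw hall haw
  · exact case_two hn G h1 h2 v a b w ha hb hab hwv hvw hall hbw

/-- If `G` is a {θ(1,2,2), F₅}-free graph on `n ≥ 6` vertices, then
`q(G) ≤ q(S_{n,1}⁺)`, with equality iff `G ≅ S_{n,1}⁺`. -/
theorem stmt2 (n : ℕ) (hn : 6 ≤ n) (G : SimpleGraph (Fin n))
    (h1 : ¬ contains theta122 G) (h2 : ¬ contains (friendship 5) G) :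
    qrad G ≤ qrad (Splus n) ∧
      (qrad G = qrad (Splus n) ↔ Nonempty (G ≃g Splus n)) := by
  have hs := qrad_splus n hn
  rcases main_dichotomy hn G h1 h2 with h | h
  · obtain ⟨e⟩ := h
    exact ⟨(qrad_iso e).le, fun _ => ⟨e⟩, fun _ => qrad_iso e⟩
  · refine ⟨h.trans hs.le, fun he => ?_, fun ⟨e⟩ => qrad_iso e⟩
    rw [he] at h
    exact absurd h (not_le.2 hs)
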